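/- arXiv:1902.03700 — 5 statements merged into one kernel-verified Lean document; each statement's English description precedes it below -/
import Mathlib

section
/- Let (PM_i, f_i) and (PM_j, f_j) be LPMs of Q in the same fragment F_k such that (a) PM_i and PM_j contain exactly the same crossing edges of F_k, and (b) for every crossing edge (u, u') contained in them, f_i^{-1}(u) = f_j^{-1}(u) and f_i^{-1}(u') = f_j^{-1}(u'). Then f_i^{-1}(PM_i) = f_j^{-1}(PM_j), i.e., a query vertex v satisfies f_i(v) ≠ NULL if and only if f_j(v) ≠ NULL, and the subgraphs of Q induced by the matched query vertices of the two LPMs are equal. -/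
section RDF

variable {V : Type} {VQ : Type} {k : ℕ}

/-- `e` is a crossing edge of fragment `i`: an edge of `E` with exactly one
endpoint in block `i` of the partition given by `frag`. -/
def Crossing (E : Set (V × V)) (frag : V → Fin k) (i : Fin k) (e : V × V) : Prop :=
  e ∈ E ∧ ((frag e.1 = i ∧ frag e.2 ≠ i) ∨ (frag e.1 ≠ i ∧ frag e.2 = i))

/-- `u` is an extended vertex of fragment `i`: an endpoint, lying outside block `i`,
of a crossing edge of fragment `i`. -/
def Extended (E : Set (V × V)) (frag : V → Fin k) (i : Fin k) (u : V) : Prop :=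
  frag u ≠ i ∧ ∃ u', Crossing E frag i (u, u') ∨ Crossing E frag i (u', u)

/-- `e` is an edge of fragment `i`: an internal edge (both endpoints in block `i`)
or a crossing edge of fragment `i`. -/
def FragEdge (E : Set (V × V)) (frag : V → Fin k) (i : Fin k) (e : V × V) : Prop :=
  (e ∈ E ∧ frag e.1 = i ∧ frag e.2 = i) ∨ Crossing E frag i e

/-- `u` is a vertex of the subgraph `PM` given by its edge set `pmE`. -/
def PMVert (pmE : Set (V × V)) (u : V) : Prop :=
  ∃ u', (u, u') ∈ pmE ∨ (u', u) ∈ pmE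

/-- undirected adjacency in the subgraph given by edge set `pmE`. -/
def PMAdj (pmE : Set (V × V)) (a b : V) : Prop :=
  (a, b) ∈ pmE ∨ (b, a) ∈ pmE

/-- The query graph (with edge set `EQ`) is (weakly) connected. -/
def QConnected (EQ : Set (VQ × VQ)) : Prop :=
  ∀ x y : VQ, Relation.ReflTransGen (fun a b => (a, b) ∈ EQ ∨ (b, a) ∈ EQ) x y

/-- Query vertex `x` is matched by `f` to an internal vertex of fragment `i`. -/
def MapsInternal (frag : V → Fin k) (i : Fin k) (f : VQ → Option V) (x : VQ) : Prop :=
  ∃ c, f x = some c ∧ frag c = i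

/-- One step of a weakly connected path in the query graph all of whose vertices are
mapped by `f` to internal vertices of fragment `i`. -/
def QStepInternal (EQ : Set (VQ × VQ)) (frag : V → Fin k) (i : Fin k)
    (f : VQ → Option V) (x y : VQ) : Prop :=
  ((x, y) ∈ EQ ∨ (y, x) ∈ EQ) ∧ MapsInternal frag i f x ∧ MapsInternal frag i f y

/-- `(pmE, f)` is a local partial match (LPM) of the query graph `(VQ, EQ)` in
fragment `i` of the distributed RDF graph `(V, E, frag)`.  The subgraph `PM` is
given by its edge set `pmE`; `f v = none` encodes `f(v) = NULL`. -/
structure IsLPM (E : Set (V × V)) (frag : V → Fin k) (EQ : Set (VQ × VQ)) (i : Fin k)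
    (pmE : Set (V × V)) (f : VQ → Option V) : Prop where
  /-- PM is a subgraph of fragment `i`. -/
  edges_frag : ∀ e ∈ pmE, FragEdge E frag i e
  /-- `f` maps query vertices into vertices(PM) ∪ {NULL}. -/
  maps_to_pm : ∀ v u, f v = some u → PMVert pmE u
  /-- PM is (weakly) connected. -/
  pm_connected : ∀ a b, PMVert pmE a → PMVert pmE b → Relation.ReflTransGen (PMAdj pmE) a b
  /-- (i) every edge of PM is the image of some query edge. -/
  edge_image : ∀ e ∈ pmE, ∃ v v', (v, v') ∈ EQ ∧ f v = some e.1 ∧ f v' = some e.2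
  /-- (ii) every query edge is realized in PM, or both endpoints map to extended
  vertices, or an endpoint maps to NULL. -/
  query_edge : ∀ v v', (v, v') ∈ EQ →
      (∃ a b, f v = some a ∧ f v' = some b ∧ (a, b) ∈ pmE) ∨
      (∃ a b, f v = some a ∧ f v' = some b ∧ Extended E frag i a ∧ Extended E frag i b) ∨
      f v = none ∨ f v' = none
  /-- (iii) PM contains at least one crossing edge of fragment `i`. -/
  has_crossing : ∃ e ∈ pmE, Crossing E frag i e
  /-- (iv), outgoing edges. -/
  internal_closed_out : ∀ v a, f v = some a → frag a = i →
      ∀ v', (v, v') ∈ EQ → ∃ b, f v' = some b ∧ (a, b) ∈ pmE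
  /-- (iv), incoming edges. -/
  internal_closed_in : ∀ v a, f v = some a → frag a = i →
      ∀ v', (v', v) ∈ EQ → ∃ b, f v' = some b ∧ (b, a) ∈ pmE
  /-- (v) query vertices mapped to internal vertices are weakly connected in `Q`
  through vertices mapped to internal vertices. -/
  internal_conn : ∀ v v' a b, f v = some a → f v' = some b → frag a = i → frag b = i →
      Relation.ReflTransGen (QStepInternal EQ frag i f) v v'

/-- A bundled local partial match of the query graph `(VQ, EQ)` in some fragment. -/
structure LPM (E : Set (V × V)) (frag : V → Fin k) (EQ : Set (VQ × VQ)) : Type where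
  fragIdx : Fin k
  pmE : Set (V × V)
  f : VQ → Option V
  isLPM : IsLPM E frag EQ fragIdx pmE f

/-- The equivalence `∼` of local partial matches: same fragment, exactly the same
crossing edges, and the same preimages at the endpoints of every crossing edge. -/
def LPMEquiv {E : Set (V × V)} {frag : V → Fin k} {EQ : Set (VQ × VQ)}
    (P P' : LPM E frag EQ) : Prop :=
  P.fragIdx = P'.fragIdx ∧
  {e | e ∈ P.pmE ∧ Crossing E frag P.fragIdx e} =
    {e | e ∈ P'.pmE ∧ Crossing E frag P.fragIdx e} ∧
  ∀ e ∈ P.pmE, Crossing E frag P.fragIdx e →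
    {v | P.f v = some e.1} = {v | P'.f v = some e.1} ∧
    {v | P.f v = some e.2} = {v | P'.f v = some e.2}

/-- Two local partial matches are joinable: different fragments, a common crossing edge
matched by the same query edge in both, and the functions are conflict-free. -/
def Joinable {E : Set (V × V)} {frag : V → Fin k} {EQ : Set (VQ × VQ)}
    (P P' : LPM E frag EQ) : Prop :=
  P.fragIdx ≠ P'.fragIdx ∧
  (∃ u u' v v', (v, v') ∈ EQ ∧
      P.f v = some u ∧ P.f v' = some u' ∧ P'.f v = some u ∧ P'.f v' = some u' ∧
      (u, u') ∈ P.pmE ∧ (u, u') ∈ P'.pmE ∧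
      Crossing E frag P.fragIdx (u, u') ∧ Crossing E frag P'.fragIdx (u, u')) ∧
  ∀ v a b, P.f v = some a → P'.f v = some b → a = b

/-- An LEC feature: a fragment identifier, the mapping `g` from crossing edges to query
edges, and the `LECSign` bitstring (modelled as the set of query vertices whose bit is 1). -/
structure LECFeature (V VQ : Type) (k : ℕ) : Type where
  fragIdx : Fin k
  g : Set ((V × V) × (VQ × VQ))
  sign : Set VQ

/-- The LEC feature of a local partial match. -/
def lecFeature {E : Set (V × V)} {frag : V → Fin k} {EQ : Set (VQ × VQ)}
    (P : LPM E frag EQ) : LECFeature V VQ k where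
  fragIdx := P.fragIdx
  g := {p | p.1 ∈ P.pmE ∧ Crossing E frag P.fragIdx p.1 ∧ p.2 ∈ EQ ∧
            P.f p.2.1 = some p.1.1 ∧ P.f p.2.2 = some p.1.2}
  sign := {x | MapsInternal frag P.fragIdx P.f x}

/-- Joinability of two LEC features. -/
def FeatJoinable (L L' : LECFeature V VQ k) : Prop :=
  L.fragIdx ≠ L'.fragIdx ∧
  (L.g ∩ L'.g).Nonempty ∧
  (¬ ∃ e e' q, (e, q) ∈ L.g ∧ (e', q) ∈ L'.g ∧ e ≠ e') ∧
  L.sign ∩ L'.sign = ∅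

/-- An extended vertex of an LPM lies on one of its crossing edges, so two maps with the same
preimages at the endpoints of crossing edges have the same preimage there. -/
theorem IsLPM.eq_some_iff_of_extended {E : Set (V × V)} {frag : V → Fin k}
    {EQ : Set (VQ × VQ)} {i : Fin k} {pmE : Set (V × V)} {f f₁ f₂ : VQ → Option V}
    (hf : IsLPM E frag EQ i pmE f)
    (hpre : ∀ e ∈ pmE, Crossing E frag i e →
      {v | f₁ v = some e.1} = {v | f₂ v = some e.1} ∧
      {v | f₁ v = some e.2} = {v | f₂ v = some e.2})
    {u : V} (hu : PMVert pmE u) (hext : frag u ≠ i) (v : VQ) :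
    f₁ v = some u ↔ f₂ v = some u := by
  obtain ⟨w, he | he⟩ := hu
  · rcases hf.edges_frag _ he with h | h
    · exact absurd h.2.1 hext
    · exact Set.ext_iff.1 (hpre _ he h).1 v
  · rcases hf.edges_frag _ he with h | h
    · exact absurd h.2.2 hext
    · exact Set.ext_iff.1 (hpre _ he h).2 v

/-- An LPM maps some query vertex to the internal endpoint of one of its crossing edges, so another
map with the same preimages at crossing edges does so too. -/
theorem IsLPM.exists_common_internal {E : Set (V × V)} {frag : V → Fin k}
    {EQ : Set (VQ × VQ)} {i : Fin k} {pmE : Set (V × V)} {f g : VQ → Option V}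
    (hf : IsLPM E frag EQ i pmE f)
    (hpre : ∀ e ∈ pmE, Crossing E frag i e →
      {v | f v = some e.1} = {v | g v = some e.1} ∧
      {v | f v = some e.2} = {v | g v = some e.2}) :
    ∃ v, MapsInternal frag i f v ∧ MapsInternal frag i g v := by
  obtain ⟨e, he, hc⟩ := hf.has_crossing
  obtain ⟨v, v', -, hv, hv'⟩ := hf.edge_image e he
  have hp := hpre e he hc
  rcases hc.2 with h | h
  · exact ⟨v, ⟨_, hv, h.1⟩, _, (Set.ext_iff.1 hp.1 v).1 hv, h.1⟩
  · exact ⟨v', ⟨_, hv', h.2⟩, _, (Set.ext_iff.1 hp.2 v').1 hv', h.2⟩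

/-- A query neighbour of a vertex mapped to an internal vertex is matched. -/
theorem IsLPM.exists_eq_some_of_adj {E : Set (V × V)} {frag : V → Fin k}
    {EQ : Set (VQ × VQ)} {i : Fin k} {pmE : Set (V × V)} {f : VQ → Option V}
    (hf : IsLPM E frag EQ i pmE f) {x y : VQ} (hx : MapsInternal frag i f x)
    (hxy : (x, y) ∈ EQ ∨ (y, x) ∈ EQ) : ∃ b, f y = some b := by
  obtain ⟨a, ha, hai⟩ := hx
  rcases hxy with h | h
  · exact (hf.internal_closed_out x a ha hai y h).imp fun _ hb => hb.1
  · exact (hf.internal_closed_in x a ha hai y h).imp fun _ hb => hb.1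

/-- Every query vertex matched by an LPM is matched by any LPM with the same preimages at crossing
edges. -/
theorem IsLPM.matched_of_matched {E : Set (V × V)} {frag : V → Fin k}
    {EQ : Set (VQ × VQ)} {i : Fin k} {pmE pmE' : Set (V × V)} {f g : VQ → Option V}
    (hf : IsLPM E frag EQ i pmE f) (hg : IsLPM E frag EQ i pmE' g)
    (hpre : ∀ e ∈ pmE, Crossing E frag i e →
      {v | f v = some e.1} = {v | g v = some e.1} ∧
      {v | f v = some e.2} = {v | g v = some e.2})
    (hpre' : ∀ e ∈ pmE', Crossing E frag i e →
      {v | f v = some e.1} = {v | g v = some e.1} ∧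
      {v | f v = some e.2} = {v | g v = some e.2})
    {v : VQ} (hv : f v ≠ none) : g v ≠ none := by
  obtain ⟨u, hu⟩ := Option.ne_none_iff_exists'.1 hv
  by_cases hui : frag u = i
  · obtain ⟨v₀, ⟨c, hc, hci⟩, hg₀⟩ := hf.exists_common_internal hpre
    have hpath := hf.internal_conn v₀ v c u hc hu hci hui
    have hint : MapsInternal frag i g v := by
      clear hv hu
      induction hpath with
      | refl => exact hg₀
      | tail _ hstep ih =>
        obtain ⟨hadj, -, a, ha, hai⟩ := hstep
        obtain ⟨b, hb⟩ := hg.exists_eq_some_of_adj ih hadj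
        refine ⟨b, hb, ?_⟩
        by_contra hbi
        have hfb := (hg.eq_some_iff_of_extended hpre' (hg.maps_to_pm _ _ hb) hbi _).2 hb
        rw [ha, Option.some_inj] at hfb
        exact hbi (hfb ▸ hai)
    obtain ⟨b, hb, -⟩ := hint
    simp [hb]
  · simp [(hf.eq_some_iff_of_extended hpre (hf.maps_to_pm _ _ hu) hui v).1 hu]

/-- Two LPMs of `Q` in the same fragment with the same crossing edges and the same
preimages at crossing-edge endpoints match the same query vertices, and induce the
same subgraph of `Q`. -/
theorem stmt0 [Fintype V] [Fintype VQ]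
    (E : Set (V × V)) (frag : V → Fin k) (EQ : Set (VQ × VQ)) (hQconn : QConnected EQ)
    (i : Fin k) (pmEi pmEj : Set (V × V)) (fi fj : VQ → Option V)
    (hi : IsLPM E frag EQ i pmEi fi) (hj : IsLPM E frag EQ i pmEj fj)
    (hsame : {e | e ∈ pmEi ∧ Crossing E frag i e} = {e | e ∈ pmEj ∧ Crossing E frag i e})
    (hpre : ∀ e ∈ pmEi, Crossing E frag i e →
        {v | fi v = some e.1} = {v | fj v = some e.1} ∧
        {v | fi v = some e.2} = {v | fj v = some e.2}) :
    (∀ v, fi v ≠ none ↔ fj v ≠ none) ∧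
    {q ∈ EQ | fi q.1 ≠ none ∧ fi q.2 ≠ none} = {q ∈ EQ | fj q.1 ≠ none ∧ fj q.2 ≠ none} := by
  have hpre' : ∀ e ∈ pmEj, Crossing E frag i e →
      {v | fi v = some e.1} = {v | fj v = some e.1} ∧
      {v | fi v = some e.2} = {v | fj v = some e.2} :=
    fun e he hc => hpre e ((Set.ext_iff.1 hsame e).2 ⟨he, hc⟩).1 hc
  have key : ∀ v, fi v ≠ none ↔ fj v ≠ none := fun v =>
    ⟨hi.matched_of_matched hj hpre hpre',
      hj.matched_of_matched hi
        (fun e he hc => ⟨(hpre' e he hc).1.symm, (hpre' e he hc).2.symm⟩)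
        (fun e he hc => ⟨(hpre e he hc).1.symm, (hpre e he hc).2.symm⟩)⟩
  exact ⟨key, by simp only [key]⟩

end RDF
end

section
/- Let (PM_i, f_i) and (PM_j, f_j) be LPMs of Q in the same fragment F_k such that (a) PM_i and PM_j contain exactly the same crossing edges of F_k, and (b) for every crossing edge (u, u') contained in them, f_i^{-1}(u) = f_j^{-1}(u) and f_i^{-1}(u') = f_j^{-1}(u'). Then for every query vertex v, f_i(v) is an internal vertex of F_k if and only if f_j(v) is an internal vertex of F_k. -/
section RDF

variable {V : Type} {VQ : Type} {k : ℕ}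

/-- If every crossing edge of `pmE'` has the same endpoint preimages under `f` and `f'`, then
every query vertex matched internally by `f` is matched internally by `f'`. -/
theorem IsLPM.mapsInternal_of_preimage_eq {E : Set (V × V)} {frag : V → Fin k}
    {EQ : Set (VQ × VQ)} {i : Fin k} {pmE pmE' : Set (V × V)} {f f' : VQ → Option V}
    (h : IsLPM E frag EQ i pmE f) (h' : IsLPM E frag EQ i pmE' f')
    (hpre : ∀ e ∈ pmE', Crossing E frag i e →
        {v | f v = some e.1} = {v | f' v = some e.1} ∧
        {v | f v = some e.2} = {v | f' v = some e.2})
    {v : VQ} (hv : MapsInternal frag i f v) : MapsInternal frag i f' v := by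
  have anchor : ∃ w c, f w = some c ∧ f' w = some c ∧ frag c = i := by
    obtain ⟨e, he, hc⟩ := h'.has_crossing
    obtain ⟨w, w', -, hw, hw'⟩ := h'.edge_image e he
    obtain ⟨h1, h2⟩ := hpre e he hc
    rcases hc.2 with ⟨hi, -⟩ | ⟨-, hi⟩
    · exact ⟨w, e.1, (Set.ext_iff.mp h1 w).mpr hw, hw, hi⟩
    · exact ⟨w', e.2, (Set.ext_iff.mp h2 w').mpr hw', hw', hi⟩
  obtain ⟨w, c, hwf, hwf', hci⟩ := anchor
  obtain ⟨a, hva, hai⟩ := hv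
  have path := h.internal_conn w v c a hwf hva hci hai
  clear hva
  induction path with
  | refl => exact ⟨c, hwf', hci⟩
  | @tail x y _ step ih =>
    obtain ⟨b, hb, hbi⟩ := ih
    obtain ⟨hxy, -, d, hd, hdi⟩ := step
    rcases hxy with hxy | hxy
    · obtain ⟨b', hb', hmem⟩ := h'.internal_closed_out x b hb hbi y hxy
      rcases h'.edges_frag _ hmem with ⟨-, -, hint⟩ | hcross
      · exact ⟨b', hb', hint⟩
      · have hy : f y = some b' := (Set.ext_iff.mp (hpre _ hmem hcross).2 y).mpr hb'
        obtain rfl : d = b' := Option.some.inj (hd.symm.trans hy)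
        exact ⟨d, hb', hdi⟩
    · obtain ⟨b', hb', hmem⟩ := h'.internal_closed_in x b hb hbi y hxy
      rcases h'.edges_frag _ hmem with ⟨-, hint, -⟩ | hcross
      · exact ⟨b', hb', hint⟩
      · have hy : f y = some b' := (Set.ext_iff.mp (hpre _ hmem hcross).1 y).mpr hb'
        obtain rfl : d = b' := Option.some.inj (hd.symm.trans hy)
        exact ⟨d, hb', hdi⟩

/-- Two LPMs of `Q` in the same fragment with the same crossing edges and the same
preimages at crossing-edge endpoints map exactly the same query vertices to internal
vertices of the fragment. -/
theorem stmt1 [Fintype V] [Fintype VQ]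
    (E : Set (V × V)) (frag : V → Fin k) (EQ : Set (VQ × VQ)) (hQconn : QConnected EQ)
    (i : Fin k) (pmEi pmEj : Set (V × V)) (fi fj : VQ → Option V)
    (hi : IsLPM E frag EQ i pmEi fi) (hj : IsLPM E frag EQ i pmEj fj)
    (hsame : {e | e ∈ pmEi ∧ Crossing E frag i e} = {e | e ∈ pmEj ∧ Crossing E frag i e})
    (hpre : ∀ e ∈ pmEi, Crossing E frag i e →
        {v | fi v = some e.1} = {v | fj v = some e.1} ∧
        {v | fi v = some e.2} = {v | fj v = some e.2}) :
    ∀ v, MapsInternal frag i fi v ↔ MapsInternal frag i fj v := by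
  refine fun v => ⟨hi.mapsInternal_of_preimage_eq hj fun e he hc => ?_,
    hj.mapsInternal_of_preimage_eq hi fun e he hc => ?_⟩
  · exact hpre e ((Set.ext_iff.mp hsame e).mpr ⟨he, hc⟩).1 hc
  · exact (hpre e he hc).imp Eq.symm Eq.symm

end RDF
end

section
/- Let (PM_1, f_1), …, (PM_m, f_m) with m ≤ |V^Q| be LPMs of Q whose functions are pairwise conflict-free (f_i(v) = f_j(v) whenever both are ≠ NULL) and whose LEC features satisfy: (1) for every i there exists j ≠ i such that the LEC features of PM_i and PM_j are joinable; (2) for all i ≠ j, the bitwise AND of the LECSigns of PM_i and PM_j is the all-zero bitstring; and (3) the bitwise OR of all m LECSigns is the all-one bitstring. Then the join f of f_1, …, f_m is a total function on V^Q (f(v) ≠ NULL for every query vertex v) and f is a match of Q in G. -/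
section RDF

variable {V : Type} {VQ : Type} {k : ℕ}

/-- If `m ≤ |V^Q|` pairwise conflict-free LPMs have LEC features such that each one is
joinable with some other, the LECSigns are pairwise disjoint, and the LECSigns cover
all query vertices, then their join is total and is a match of `Q` in `G`. -/
theorem stmt5 [Fintype V] [Fintype VQ]
    (E : Set (V × V)) (frag : V → Fin k) (EQ : Set (VQ × VQ)) (hQconn : QConnected EQ)
    (m : ℕ) (hm : m ≤ Fintype.card VQ)
    (P : Fin m → LPM E frag EQ)
    (hcf : ∀ i j v a b, (P i).f v = some a → (P j).f v = some b → a = b)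
    (h1 : ∀ i, ∃ j, j ≠ i ∧ FeatJoinable (lecFeature (P i)) (lecFeature (P j)))
    (h2 : ∀ i j, i ≠ j → (lecFeature (P i)).sign ∩ (lecFeature (P j)).sign = ∅)
    (h3 : (⋃ i, (lecFeature (P i)).sign) = Set.univ)
    (h : VQ → Option V)
    (hjoin1 : ∀ v i a, (P i).f v = some a → h v = some a)
    (hjoin2 : ∀ v, (∀ i, (P i).f v = none) → h v = none) :
    (∀ v, h v ≠ none) ∧
    ∀ q ∈ EQ, ∃ a b, h q.1 = some a ∧ h q.2 = some b ∧ (a, b) ∈ E := by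
  have total : ∀ v, ∃ i a, (P i).f v = some a ∧ frag a = (P i).fragIdx := fun v => by
    obtain ⟨i, a, hf, ha⟩ := Set.mem_iUnion.mp (h3 ▸ Set.mem_univ v)
    exact ⟨i, a, hf, ha⟩
  constructor
  · intro v hv
    obtain ⟨i, a, hf, -⟩ := total v
    simp [hjoin1 v i a hf] at hv
  · rintro ⟨v, v'⟩ hq
    obtain ⟨i, a, hf, ha⟩ := total v
    obtain ⟨b, hb, he⟩ := (P i).isLPM.internal_closed_out v a hf ha v' hq
    exact ⟨a, b, hjoin1 v i a hf, hjoin1 v' i b hb,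
      ((P i).isLPM.edges_frag _ he).elim And.left And.left⟩
end RDF
end

section
/- Let LF_i and LF_j be the LEC features of two LPMs of Q. If the LECSign bitstring of LF_i is equal to the LECSign bitstring of LF_j, then LF_i and LF_j are not joinable. -/
section RDF

variable {V : Type} {VQ : Type} {k : ℕ}

/-- The LECSign of a local partial match is nonempty, since a crossing edge has an
internal endpoint. -/
theorem lecFeature_sign_nonempty {E : Set (V × V)} {frag : V → Fin k} {EQ : Set (VQ × VQ)}
    (P : LPM E frag EQ) : (lecFeature P).sign.Nonempty := by
  obtain ⟨e, he, -, hc⟩ := P.isLPM.has_crossing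
  obtain ⟨v, v', -, hv, hv'⟩ := P.isLPM.edge_image e he
  rcases hc with ⟨h, -⟩ | ⟨-, h⟩
  · exact ⟨v, e.1, hv, h⟩
  · exact ⟨v', e.2, hv', h⟩

/-- If the LECSigns of the LEC features of two LPMs are equal, the features are not
joinable. -/
theorem stmt7 [Fintype V] [Fintype VQ]
    (E : Set (V × V)) (frag : V → Fin k) (EQ : Set (VQ × VQ)) (hQconn : QConnected EQ)
    (P P' : LPM E frag EQ)
    (hsign : (lecFeature P).sign = (lecFeature P').sign) :
    ¬ FeatJoinable (lecFeature P) (lecFeature P') := by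
  rintro ⟨-, -, -, hdisj⟩
  rw [← hsign, Set.inter_self] at hdisj
  exact (lecFeature_sign_nonempty P).ne_empty hdisj

end RDF
end

section
/- If (PM_i, f_i) and (PM_j, f_j) are equivalent LPMs of Q (PM_i ∼ PM_j), then their LEC features are equal: they have the same fragment, the same set g of pairs ((u, u'), (v, v')) of crossing edges and matching query edges, and the same LECSign bitstring. -/
section RDF

variable {V : Type} {VQ : Type} {k : ℕ}

/-- A query edge leaving a vertex that is internal for `f` is mapped by `f` to an edge of `PM`,
which is a crossing edge unless its other endpoint is internal as well. -/
theorem IsLPM.mapsInternal_or_exists_crossing {E : Set (V × V)} {frag : V → Fin k}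
    {EQ : Set (VQ × VQ)} {i : Fin k} {pmE : Set (V × V)} {f : VQ → Option V}
    (h : IsLPM E frag EQ i pmE f) {x y : VQ} (hxy : (x, y) ∈ EQ ∨ (y, x) ∈ EQ)
    (hx : MapsInternal frag i f x) :
    MapsInternal frag i f y ∨ ∃ b, frag b ≠ i ∧ f y = some b ∧
      ∃ e ∈ pmE, Crossing E frag i e ∧ (e.1 = b ∨ e.2 = b) := by
  obtain ⟨a, hxa, ha⟩ := hx
  obtain ⟨b, hyb, e, he, heb⟩ : ∃ b, f y = some b ∧ ∃ e ∈ pmE, e.1 = b ∨ e.2 = b := by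
    rcases hxy with hxy | hxy
    · obtain ⟨b, hb, he⟩ := h.internal_closed_out x a hxa ha y hxy
      exact ⟨b, hb, _, he, Or.inr rfl⟩
    · obtain ⟨b, hb, he⟩ := h.internal_closed_in x a hxa ha y hxy
      exact ⟨b, hb, _, he, Or.inl rfl⟩
  by_cases hb : frag b = i
  · exact Or.inl ⟨b, hyb, hb⟩
  · refine Or.inr ⟨b, hb, hyb, e, he, ?_, heb⟩
    rcases h.edges_frag e he with ⟨-, h1, h2⟩ | hc
    · rcases heb with rfl | rfl <;> contradiction
    · exact hc

/-- Some query vertex matched to an endpoint of a crossing edge of `PM` is internal. -/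
theorem IsLPM.exists_mapsInternal_crossing {E : Set (V × V)} {frag : V → Fin k}
    {EQ : Set (VQ × VQ)} {i : Fin k} {pmE : Set (V × V)} {f : VQ → Option V}
    (h : IsLPM E frag EQ i pmE f) :
    ∃ e ∈ pmE, Crossing E frag i e ∧
      ∃ x a, (e.1 = a ∨ e.2 = a) ∧ f x = some a ∧ frag a = i := by
  obtain ⟨e, he, hc⟩ := h.has_crossing
  obtain ⟨v, v', -, hv, hv'⟩ := h.edge_image e he
  rcases hc.2 with ⟨hi, -⟩ | ⟨-, hi⟩
  · exact ⟨e, he, hc, v, e.1, Or.inl rfl, hv, hi⟩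
  · exact ⟨e, he, hc, v', e.2, Or.inr rfl, hv', hi⟩

theorem LPMEquiv.symm {E : Set (V × V)} {frag : V → Fin k} {EQ : Set (VQ × VQ)}
    {P P' : LPM E frag EQ} (h : LPMEquiv P P') : LPMEquiv P' P := by
  obtain ⟨hi, hc, hp⟩ := h
  refine ⟨hi.symm, hi ▸ hc.symm, fun e he hce => ?_⟩
  rw [← hi] at hce
  have hmem : e ∈ P.pmE ∧ Crossing E frag P.fragIdx e := hc.symm.subset ⟨he, hce⟩
  exact ⟨(hp e hmem.1 hce).1.symm, (hp e hmem.1 hce).2.symm⟩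

theorem LPMEquiv.apply_eq_some_iff {E : Set (V × V)} {frag : V → Fin k} {EQ : Set (VQ × VQ)}
    {P P' : LPM E frag EQ} (h : LPMEquiv P P') {e : V × V} (he : e ∈ P.pmE)
    (hc : Crossing E frag P.fragIdx e) {b : V} (hb : e.1 = b ∨ e.2 = b) (x : VQ) :
    P.f x = some b ↔ P'.f x = some b := by
  rcases hb with rfl | rfl
  · exact Set.ext_iff.mp (h.2.2 e he hc).1 x
  · exact Set.ext_iff.mp (h.2.2 e he hc).2 x

theorem LPMEquiv.g_subset {E : Set (V × V)} {frag : V → Fin k} {EQ : Set (VQ × VQ)}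
    {P P' : LPM E frag EQ} (h : LPMEquiv P P') : (lecFeature P).g ⊆ (lecFeature P').g := by
  rintro p ⟨he, hc, hq, h1, h2⟩
  have hmem : p.1 ∈ P'.pmE ∧ Crossing E frag P.fragIdx p.1 := h.2.1.subset ⟨he, hc⟩
  exact ⟨hmem.1, h.1 ▸ hc, hq, (h.apply_eq_some_iff he hc (Or.inl rfl) _).mp h1,
    (h.apply_eq_some_iff he hc (Or.inr rfl) _).mp h2⟩

theorem LPMEquiv.sign_subset {E : Set (V × V)} {frag : V → Fin k} {EQ : Set (VQ × VQ)}
    {P P' : LPM E frag EQ} (h : LPMEquiv P P') :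
    (lecFeature P).sign ⊆ (lecFeature P').sign := by
  rintro y ⟨b, hyb, hb⟩
  obtain ⟨e, he, hc, x, a, hea, hxa, ha⟩ := P.isLPM.exists_mapsInternal_crossing
  change MapsInternal frag P'.fragIdx P'.f y
  induction P.isLPM.internal_conn x y a b hxa hyb ha hb generalizing b with
  | refl => exact ⟨a, (h.apply_eq_some_iff he hc hea x).mp hxa, ha.trans h.1⟩
  | tail _ hstep ih =>
    obtain ⟨hedge, ⟨c, hzc, hci⟩, -⟩ := hstep
    rcases P'.isLPM.mapsInternal_or_exists_crossing hedge (ih c hzc hci) with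
      hint | ⟨d, hd, hyd, e', he', hc', hed⟩
    · exact hint
    · rw [(h.symm.apply_eq_some_iff he' hc' hed _).mp hyd, Option.some_inj] at hyb
      exact absurd (hyb ▸ hb.trans h.1) hd

/-- Equivalent LPMs have equal LEC features: same fragment, same mapping `g` of crossing
edges to query edges, and same LECSign. -/
theorem stmt12 [Fintype V] [Fintype VQ]
    (E : Set (V × V)) (frag : V → Fin k) (EQ : Set (VQ × VQ)) (hQconn : QConnected EQ)
    (P P' : LPM E frag EQ) (h : LPMEquiv P P') :
    lecFeature P = lecFeature P' := by
  have hi : (lecFeature P).fragIdx = (lecFeature P').fragIdx := h.1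
  have hg := h.g_subset.antisymm h.symm.g_subset
  have hs := h.sign_subset.antisymm h.symm.sign_subset
  revert hi hg hs
  cases lecFeature P
  cases lecFeature P'
  rintro rfl rfl rfl
  rfl

end RDF
end
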